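/- Let Ω ⊂ ℝⁿ be an (ε,δ)-domain, λ := λ_{ε,δ}, and f ∈ bmo_λ(Ω). Then there exist bounded Lipschitz functions g_j on Ω with dist(supp g_j, ∂Ω) > 0 and ‖f − g_j‖_{bmo_λ(Ω)} → 0 if and only if lim_{t→0⁺} ω_Ω(f,t) = 0. -/

import Mathlib

open MeasureTheory Metric Filter Topology

noncomputable section

/-- A closed axis-parallel cube in ℝⁿ: a closed ball in the sup norm with
positive radius (`half` = half the sidelength). -/
structure Cube (n : ℕ) where
  center : Fin n → ℝ
  half : ℝ
  half_pos : 0 < half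

namespace Cube

variable {n : ℕ}

/-- The underlying set of a cube. -/
def toSet (Q : Cube n) : Set (Fin n → ℝ) := Metric.closedBall Q.center Q.half

/-- The sidelength ℓ(Q). -/
def side (Q : Cube n) : ℝ := 2 * Q.half

/-- The mean f_Q of f over Q. -/
def avg (Q : Cube n) (f : (Fin n → ℝ) → ℝ) : ℝ := ⨍ x in Q.toSet, f x

/-- Mean oscillation of f over Q. -/
def osc (Q : Cube n) (f : (Fin n → ℝ) → ℝ) : ℝ := ⨍ x in Q.toSet, |f x - Q.avg f|

/-- The mean |f|_Q of |f| over Q. -/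
def avgAbs (Q : Cube n) (f : (Fin n → ℝ) → ℝ) : ℝ := ⨍ x in Q.toSet, |f x|

/-- Distance from the cube to the origin. -/
def distToOrigin (Q : Cube n) : ℝ := Metric.infDist (0 : Fin n → ℝ) Q.toSet

/-- The cube 2Q, concentric with Q and of twice the sidelength. -/
def double (Q : Cube n) : Cube n := ⟨Q.center, 2 * Q.half, mul_pos two_pos Q.half_pos⟩

end Cube

variable {n : ℕ}

/-- The modulus of mean oscillation ω_U(f,t): the supremum of the mean oscillation
of f over cubes Q ⊆ U of sidelength < t. -/
def omegaOn (U : Set (Fin n → ℝ)) (f : (Fin n → ℝ) → ℝ) (t : ℝ) : ℝ :=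
  sSup {r | ∃ Q : Cube n, Q.toSet ⊆ U ∧ Q.side < t ∧ r = Q.osc f}

/-- sup{ |f|_Q : Q ⊆ U, ℓ(Q) ≥ lam }. -/
def bigAvgSup (U : Set (Fin n → ℝ)) (lam : ℝ) (f : (Fin n → ℝ) → ℝ) : ℝ :=
  sSup {r | ∃ Q : Cube n, Q.toSet ⊆ U ∧ lam ≤ Q.side ∧ r = Q.avgAbs f}

/-- The nonhomogeneous norm ‖f‖_{bmo_lam(U)}. -/
def bmoNorm (U : Set (Fin n → ℝ)) (lam : ℝ) (f : (Fin n → ℝ) → ℝ) : ℝ :=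
  omegaOn U f lam + bigAvgSup U lam f

/-- Membership in bmo_lam(U): integrable on every cube in U and finite norm. -/
def MemBmo (U : Set (Fin n → ℝ)) (lam : ℝ) (f : (Fin n → ℝ) → ℝ) : Prop :=
  (∀ Q : Cube n, Q.toSet ⊆ U → IntegrableOn f Q.toSet) ∧
  BddAbove {r | ∃ Q : Cube n, Q.toSet ⊆ U ∧ Q.side < lam ∧ r = Q.osc f} ∧
  BddAbove {r | ∃ Q : Cube n, Q.toSet ⊆ U ∧ lam ≤ Q.side ∧ r = Q.avgAbs f}

/-- Sarason's vanishing mean oscillation condition: ω_U(f,t) → 0 as t → 0⁺. -/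
def VanishSmallOsc (U : Set (Fin n → ℝ)) (f : (Fin n → ℝ) → ℝ) : Prop :=
  Tendsto (fun t => omegaOn U f t) (nhdsWithin 0 (Set.Ioi 0)) (nhds 0)

/-- f is bounded on U. -/
def BoundedOn (U : Set (Fin n → ℝ)) (f : (Fin n → ℝ) → ℝ) : Prop :=
  ∃ M : ℝ, ∀ x ∈ U, |f x| ≤ M

/-- f is Lipschitz on U. -/
def LipschitzOn (U : Set (Fin n → ℝ)) (f : (Fin n → ℝ) → ℝ) : Prop :=
  ∃ K : NNReal, LipschitzOnWith K f U

/-- dist(supp f, ∂U) > 0. -/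
def SuppAway (U : Set (Fin n → ℝ)) (f : (Fin n → ℝ) → ℝ) : Prop :=
  ∃ d > 0, ∀ x ∈ Function.support f, ∀ y ∈ frontier U, d ≤ dist x y

/-- The nonhomogeneous Lipschitz norm ‖f‖_{Lip_b(U)} = ‖f‖_∞ + Lipschitz seminorm. -/
def lipbNorm (U : Set (Fin n → ℝ)) (f : (Fin n → ℝ) → ℝ) : ℝ :=
  sSup {r | ∃ x ∈ U, r = |f x|} +
  sSup {r | ∃ x ∈ U, ∃ y ∈ U, x ≠ y ∧ r = |f x - f y| / dist x y}

/-- U is a domain: a nonempty open connected subset of ℝⁿ. -/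
def IsRealDomain (U : Set (Fin n → ℝ)) : Prop := IsOpen U ∧ IsConnected U

/-- U is an (ε,δ)-domain. -/
def IsEpsDeltaDomain (U : Set (Fin n → ℝ)) (ε δ : ℝ) : Prop :=
  ∀ x ∈ U, ∀ y ∈ U, dist x y < δ →
    ∃ γ : ℝ → (Fin n → ℝ), ContinuousOn γ (Set.Icc 0 1) ∧ γ 0 = x ∧ γ 1 = y ∧
      (∀ t ∈ Set.Icc (0:ℝ) 1, γ t ∈ U) ∧
      eVariationOn γ (Set.Icc 0 1) ≤ ENNReal.ofReal (ε⁻¹ * dist x y) ∧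
      ∀ t ∈ Set.Icc (0:ℝ) 1,
        ε * (dist (γ t) x * dist (γ t) y) / dist x y ≤ Metric.infDist (γ t) (frontier U)

/-- The natural scale λ_{ε,δ} for an (ε,δ)-domain. -/
def lamED (n : ℕ) (ε δ : ℝ) : ℝ := ε ^ 2 * δ / (320 * n * (1 + Real.sqrt n * ε))

/-- d_Ω(x) = dist(x,∂Ω). -/
def distBd (U : Set (Fin n → ℝ)) (x : Fin n → ℝ) : ℝ := Metric.infDist x (frontier U)

/-- Ω̊_t = {x ∈ Ω : d_Ω(x) ≥ t}. -/
def innerPart (U : Set (Fin n → ℝ)) (t : ℝ) : Set (Fin n → ℝ) :=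
  {x ∈ U | t ≤ distBd U x}

/-- f vanishes at infinity in the bmo_lam(U) sense. -/
def VanishAtInfinity (U : Set (Fin n → ℝ)) (lam : ℝ) (f : (Fin n → ℝ) → ℝ) : Prop :=
  Tendsto (fun R => bmoNorm (U \ Metric.closedBall 0 R) lam f) atTop (nhds 0)

/-- f vanishes at the boundary in the bmo_lam(U) sense. -/
def VanishAtBoundary (U : Set (Fin n → ℝ)) (lam : ℝ) (f : (Fin n → ℝ) → ℝ) : Prop :=
  Tendsto (fun t => bmoNorm (U \ innerPart U t) lam f) (nhdsWithin 0 (Set.Ioi 0)) (nhds 0)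

/-- f is in the bmo_lam(U)-closure of the continuous functions with compact support in U. -/
def InCmoClosure (U : Set (Fin n → ℝ)) (lam : ℝ) (f : (Fin n → ℝ) → ℝ) : Prop :=
  ∃ g : ℕ → (Fin n → ℝ) → ℝ,
    (∀ j, Continuous (g j) ∧ HasCompactSupport (g j) ∧ tsupport (g j) ⊆ U) ∧
    Tendsto (fun j => bmoNorm U lam (f - g j)) atTop (nhds 0)

/-- The homogeneous BMO(ℝⁿ) seminorm: sup of mean oscillation over all cubes. -/
def bmoHNorm (f : (Fin n → ℝ) → ℝ) : ℝ := sSup {r | ∃ Q : Cube n, r = Q.osc f}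

namespace Cube

theorem volume_toSet (Q : Cube n) : volume Q.toSet = ENNReal.ofReal ((2 * Q.half) ^ n) := by
  simp [toSet, Real.volume_pi_closedBall _ Q.half_pos.le]

theorem volume_toSet_ne_top (Q : Cube n) : volume Q.toSet ≠ ⊤ := by
  simp [volume_toSet]

theorem volume_toSet_ne_zero (Q : Cube n) : volume Q.toSet ≠ 0 := by
  have := Q.half_pos
  rw [volume_toSet]
  positivity

theorem real_volume_toSet (Q : Cube n) : volume.real Q.toSet = (2 * Q.half) ^ n := by
  have := Q.half_pos
  rw [Measure.real, volume_toSet, ENNReal.toReal_ofReal (by positivity)]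

theorem real_volume_toSet_pos (Q : Cube n) : 0 < volume.real Q.toSet := by
  have := Q.half_pos
  rw [real_volume_toSet]
  positivity

theorem measurableSet_toSet (Q : Cube n) : MeasurableSet Q.toSet :=
  measurableSet_closedBall

theorem isCompact_toSet (Q : Cube n) : IsCompact Q.toSet :=
  isCompact_closedBall _ _

theorem integrableOn_const (Q : Cube n) (v : ℝ) : IntegrableOn (fun _ => v) Q.toSet :=
  (integrableOn_const_iff (by simp)).2 (Or.inr Q.volume_toSet_ne_top.lt_top)

theorem average_const (Q : Cube n) (v : ℝ) : ⨍ _ in Q.toSet, v = v :=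
  setAverage_const Q.volume_toSet_ne_zero Q.volume_toSet_ne_top v

theorem average_add (Q : Cube n) {F G : (Fin n → ℝ) → ℝ} (hF : IntegrableOn F Q.toSet)
    (hG : IntegrableOn G Q.toSet) :
    ⨍ x in Q.toSet, (F x + G x) = (⨍ x in Q.toSet, F x) + ⨍ x in Q.toSet, G x := by
  simp only [setAverage_eq, integral_add hF hG, smul_add]

theorem average_sub_const (Q : Cube n) {F : (Fin n → ℝ) → ℝ} (hF : IntegrableOn F Q.toSet)
    (v : ℝ) : ⨍ x in Q.toSet, (F x - v) = (⨍ x in Q.toSet, F x) - v := by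
  simpa [sub_eq_add_neg, Q.average_const] using Q.average_add hF (Q.integrableOn_const (-v))

theorem average_mono (Q : Cube n) {F G : (Fin n → ℝ) → ℝ} (hF : IntegrableOn F Q.toSet)
    (hG : IntegrableOn G Q.toSet) (h : ∀ x ∈ Q.toSet, F x ≤ G x) :
    ⨍ x in Q.toSet, F x ≤ ⨍ x in Q.toSet, G x := by
  simp only [setAverage_eq, smul_eq_mul]
  exact mul_le_mul_of_nonneg_left (setIntegral_mono_on hF hG Q.measurableSet_toSet h)
    (inv_nonneg.2 measureReal_nonneg)

theorem abs_average_le (Q : Cube n) (F : (Fin n → ℝ) → ℝ) :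
    |⨍ x in Q.toSet, F x| ≤ ⨍ x in Q.toSet, |F x| := by
  simp only [setAverage_eq, smul_eq_mul, abs_mul]
  rw [abs_of_nonneg (inv_nonneg.2 Q.real_volume_toSet_pos.le)]
  gcongr
  exact abs_integral_le_integral_abs

theorem average_abs_nonneg (Q : Cube n) (F : (Fin n → ℝ) → ℝ) : 0 ≤ ⨍ x in Q.toSet, |F x| :=
  (abs_nonneg _).trans (Q.abs_average_le F)

theorem osc_nonneg (Q : Cube n) (f : (Fin n → ℝ) → ℝ) : 0 ≤ Q.osc f :=
  Q.average_abs_nonneg _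

theorem integrableOn_sub_const (Q : Cube n) {F : (Fin n → ℝ) → ℝ} (hF : IntegrableOn F Q.toSet)
    (v : ℝ) : IntegrableOn (fun x => F x - v) Q.toSet :=
  Integrable.sub hF (Q.integrableOn_const v)

theorem osc_le_two_mul (Q : Cube n) {F : (Fin n → ℝ) → ℝ} (hF : IntegrableOn F Q.toSet) (v : ℝ) :
    Q.osc F ≤ 2 * ⨍ x in Q.toSet, |F x - v| := by
  have h1 : |v - Q.avg F| ≤ ⨍ x in Q.toSet, |F x - v| := by
    rw [abs_sub_comm, avg, ← Q.average_sub_const hF]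
    exact Q.abs_average_le _
  have hv := (Q.integrableOn_sub_const hF v).abs
  calc Q.osc F ≤ ⨍ x in Q.toSet, (|F x - v| + |v - Q.avg F|) :=
        Q.average_mono (Q.integrableOn_sub_const hF _).abs (hv.add (Q.integrableOn_const _))
          fun x _ => abs_sub_le _ _ _
    _ = (⨍ x in Q.toSet, |F x - v|) + |v - Q.avg F| := by
        rw [Q.average_add hv (Q.integrableOn_const _), Q.average_const]
    _ ≤ _ := by linarith

theorem osc_add_le (Q : Cube n) {F G : (Fin n → ℝ) → ℝ} (hF : IntegrableOn F Q.toSet)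
    (hG : IntegrableOn G Q.toSet) : Q.osc (F + G) ≤ Q.osc F + Q.osc G := by
  have hF' := (Q.integrableOn_sub_const hF (Q.avg F)).abs
  have hG' := (Q.integrableOn_sub_const hG (Q.avg G)).abs
  have h : Q.avg (F + G) = Q.avg F + Q.avg G := Q.average_add hF hG
  rw [osc, osc, osc, ← Q.average_add hF' hG', h]
  refine Q.average_mono (Q.integrableOn_sub_const (hF.add hG) _).abs (hF'.add hG') fun x _ => ?_
  rw [Pi.add_apply, add_sub_add_comm]
  exact abs_add_le _ _

theorem average_abs_le_iff (Q : Cube n) {F : (Fin n → ℝ) → ℝ} (hF : IntegrableOn F Q.toSet)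
    {M : ℝ} (hM : 0 ≤ M) :
    ⨍ x in Q.toSet, |F x| ≤ M ↔
      ∫⁻ x in Q.toSet, ENNReal.ofReal |F x| ≤ ENNReal.ofReal M * volume Q.toSet := by
  have hpos := Q.real_volume_toSet_pos
  rw [← ofReal_integral_eq_lintegral_ofReal hF.abs (ae_of_all _ fun _ => abs_nonneg _),
    ← ENNReal.ofReal_toReal Q.volume_toSet_ne_top, ← ENNReal.ofReal_mul hM,
    ENNReal.ofReal_le_ofReal_iff (by positivity), setAverage_eq, smul_eq_mul,
    inv_mul_le_iff₀ hpos, mul_comm M]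
  rfl

theorem abs_avg_sub_le (Q P : Cube n) (hPQ : P.toSet ⊆ Q.toSet) {f : (Fin n → ℝ) → ℝ}
    (hf : IntegrableOn f Q.toSet) (v : ℝ) :
    |P.avg f - v| ≤ (Q.half / P.half) ^ n * ⨍ x in Q.toSet, |f x - v| := by
  have hP := P.half_pos
  have hQ := Q.half_pos
  have hv := Q.integrableOn_sub_const hf v
  rw [avg, ← P.average_sub_const (hf.mono_set hPQ)]
  refine (P.abs_average_le _).trans ?_
  have h : ∫ x in P.toSet, |f x - v| ≤ ∫ x in Q.toSet, |f x - v| :=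
    setIntegral_mono_set hv.abs (ae_of_all _ fun _ => abs_nonneg _) hPQ.eventuallyLE
  rw [setAverage_eq, setAverage_eq, smul_eq_mul, smul_eq_mul, real_volume_toSet,
    real_volume_toSet]
  calc _ ≤ ((2 * P.half) ^ n)⁻¹ * ∫ x in Q.toSet, |f x - v| := by gcongr
    _ = _ := by
        have h1 : (Q.half / P.half) ^ n = (2 * Q.half) ^ n / (2 * P.half) ^ n := by
          rw [← div_pow, mul_div_mul_left _ _ two_ne_zero]
        have h2 : (2 * Q.half) ^ n ≠ 0 := by positivity
        rw [h1, ← mul_assoc, div_mul_eq_mul_div, mul_inv_cancel₀ h2, one_div]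

theorem abs_avg_sub_avg_le (Q P : Cube n) (hPQ : P.toSet ⊆ Q.toSet) {f : (Fin n → ℝ) → ℝ}
    (hf : IntegrableOn f Q.toSet) : |P.avg f - Q.avg f| ≤ (Q.half / P.half) ^ n * Q.osc f :=
  abs_avg_sub_le Q P hPQ hf _

/-- A bound for the integrals over all subcubes whose half-side lies between `t / 2` and `t`
passes to every cube of half-side larger than `t`. -/
theorem lintegral_le_of_subcubes (Q : Cube n) {t : ℝ} (ht : 0 < t) (htQ : t < Q.half)
    (F : (Fin n → ℝ) → ENNReal) (M : ENNReal)
    (hF : ∀ P : Cube n, P.toSet ⊆ Q.toSet → t / 2 ≤ P.half → P.half ≤ t →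
      ∫⁻ x in P.toSet, F x ≤ M * volume P.toSet) :
    ∫⁻ x in Q.toSet, F x ≤ M * volume Q.toSet := by
  have hQ := Q.half_pos
  set N : ℕ := ⌈Q.half / t⌉₊ with hN
  have hN1 : Q.half ≤ N * t := (div_le_iff₀ ht).1 (Nat.le_ceil _)
  have hN2 : N * t < Q.half + t := by
    have := Nat.ceil_lt_add_one (a := Q.half / t) (by positivity)
    rw [← hN] at this
    calc N * t < (Q.half / t + 1) * t := by gcongr
      _ = _ := by field_simp
  have hN0 : 0 < N := Nat.ceil_pos.2 (by positivity)
  have hN0' : (0 : ℝ) < N := by exact_mod_cast hN0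
  set s : ℝ := Q.half / N with hs
  have hs0 : 0 < s := by positivity
  have hNs : N * s = Q.half := by rw [hs]; field_simp
  let P : (Fin n → Fin N) → Cube n := fun k =>
    ⟨fun i => Q.center i - Q.half + (2 * (k i : ℕ) + 1) * s, s, hs0⟩
  have hsub : ∀ k, (P k).toSet ⊆ Q.toSet := by
    intro k x hx
    simp only [toSet, mem_closedBall] at hx ⊢
    rw [dist_pi_le_iff (by positivity)] at hx ⊢
    intro i
    have := hx i
    have hk : ((k i : ℕ) : ℝ) + 1 ≤ N := by exact_mod_cast (k i).2
    simp only [P, Real.dist_eq, abs_le] at this ⊢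
    have h0 : (0 : ℝ) ≤ (k i : ℕ) := by positivity
    constructor <;> nlinarith
  have hcover : Q.toSet ⊆ ⋃ k, (P k).toSet := by
    intro x hx
    simp only [toSet, mem_closedBall] at hx
    rw [dist_pi_le_iff (by positivity)] at hx
    have key : ∀ i, ∃ k : Fin N,
        |x i - (Q.center i - Q.half + (2 * (k : ℕ) + 1) * s)| ≤ s := by
      intro i
      have hxi := hx i
      rw [Real.dist_eq, abs_le] at hxi
      set w := x i - Q.center i + Q.half with hw
      by_cases hcase : w < 2 * s * N
      · have hfl : ⌊w / (2 * s)⌋₊ < N := by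
          rw [Nat.floor_lt (div_nonneg (by linarith) (by positivity)), div_lt_iff₀ (by positivity)]
          linarith
        have h1 : (⌊w / (2 * s)⌋₊ : ℝ) * (2 * s) ≤ w :=
          (le_div_iff₀ (by positivity)).1
            (Nat.floor_le (div_nonneg (by linarith) (by positivity)))
        have h2 : w < ((⌊w / (2 * s)⌋₊ : ℝ) + 1) * (2 * s) :=
          (div_lt_iff₀ (by positivity)).1 (Nat.lt_floor_add_one _)
        refine ⟨⟨_, hfl⟩, ?_⟩
        rw [abs_le]
        constructor <;> simp only <;> linarith
      · refine ⟨⟨N - 1, by omega⟩, ?_⟩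
        have : ((N - 1 : ℕ) : ℝ) = N - 1 := by
          rw [Nat.cast_sub hN0, Nat.cast_one]
        simp only [this]
        rw [abs_le]
        constructor <;> linarith
    choose k hk using key
    refine Set.mem_iUnion.2 ⟨k, ?_⟩
    simp only [toSet, mem_closedBall]
    rw [dist_pi_le_iff hs0.le]
    exact fun i => hk i
  have hvol : ∑ k, volume (P k).toSet = volume Q.toSet := by
    simp only [volume_toSet, P, Finset.sum_const, Finset.card_univ, Fintype.card_pi,
      Fintype.card_fin, Finset.prod_const, nsmul_eq_mul]
    rw [← ENNReal.ofReal_natCast, ← ENNReal.ofReal_mul (by positivity)]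
    congr 1
    push_cast
    rw [← mul_pow, ← hNs]
    ring
  calc ∫⁻ x in Q.toSet, F x ≤ ∫⁻ x in ⋃ k, (P k).toSet, F x := lintegral_mono_set hcover
    _ ≤ ∑' k, ∫⁻ x in (P k).toSet, F x := lintegral_iUnion_le _ _
    _ = ∑ k, ∫⁻ x in (P k).toSet, F x := tsum_fintype _
    _ ≤ ∑ k, M * volume (P k).toSet := by
        refine Finset.sum_le_sum fun k _ => hF _ (hsub k) ?_ ?_
        · show t / 2 ≤ s
          rw [hs, le_div_iff₀ hN0']
          linarith
        · show s ≤ t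
          rw [hs, div_le_iff₀ hN0']
          linarith
    _ = _ := by rw [← Finset.mul_sum, hvol]

end Cube

/-- `u` changes by at most `κ` between points of `U` whose distance is at most a quarter of the
distance to the complement of `U`, the latter being truncated at `t`. -/
def CoarselyBloch (U : Set (Fin n → ℝ)) (t κ : ℝ) (u : (Fin n → ℝ) → ℝ) : Prop :=
  ∀ x ∈ U, ∀ y ∈ U, dist x y ≤ min t (infDist x Uᶜ) / 4 → |u x - u y| ≤ κ

theorem le_infDist_compl {U : Set (Fin n → ℝ)} (hU : Uᶜ.Nonempty) {x : Fin n → ℝ} {r : ℝ}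
    (h : closedBall x r ⊆ U) : r ≤ infDist x Uᶜ := by
  refine (le_infDist hU).2 fun y hy => ?_
  by_contra! hlt
  exact hy (h (by rw [mem_closedBall, dist_comm]; exact hlt.le))

theorem Cube.le_infDist_compl {U : Set (Fin n → ℝ)} (hU : Uᶜ.Nonempty) {Q : Cube n}
    (hQ : Q.toSet ⊆ U) {x : Fin n → ℝ} :
    Q.half - dist x Q.center ≤ infDist x Uᶜ := by
  refine _root_.le_infDist_compl hU (Set.Subset.trans (closedBall_subset_closedBall' ?_) hQ)
  linarith

namespace CoarselyBloch

variable {U : Set (Fin n → ℝ)} {t κ : ℝ} {u v : (Fin n → ℝ) → ℝ}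

protected theorem neg (hu : CoarselyBloch U t κ u) : CoarselyBloch U t κ (fun x => -u x) := by
  intro x hx y hy hxy
  rw [neg_sub_neg, abs_sub_comm]
  exact hu x hx y hy hxy

protected theorem max (hu : CoarselyBloch U t κ u) (hv : CoarselyBloch U t κ v) :
    CoarselyBloch U t κ (fun x => max (u x) (v x)) := fun x hx y hy hxy =>
  (abs_max_sub_max_le_max _ _ _ _).trans (max_le (hu x hx y hy hxy) (hv x hx y hy hxy))

protected theorem min (hu : CoarselyBloch U t κ u) (hv : CoarselyBloch U t κ v) :
    CoarselyBloch U t κ (fun x => min (u x) (v x)) := fun x hx y hy hxy =>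
  (abs_min_sub_min_le_max _ _ _ _).trans (max_le (hu x hx y hy hxy) (hv x hx y hy hxy))

theorem abs_sub_center_le (hu : CoarselyBloch U t κ u) (hU : Uᶜ.Nonempty) {Q : Cube n}
    (hQ : Q.toSet ⊆ U) (hQt : Q.half ≤ t) (k : ℕ) {x : Fin n → ℝ}
    (hx : dist x Q.center ≤ Q.half * (1 - (4 / 5) ^ (k + 1))) :
    |u x - u Q.center| ≤ (k + 1) * κ := by
  have hh := Q.half_pos
  have hmem : ∀ {z : Fin n → ℝ} (j : ℕ), dist z Q.center ≤ Q.half * (1 - (4 / 5) ^ j) → z ∈ U := by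
    intro z j hz
    refine hQ (mem_closedBall.2 (hz.trans ?_))
    have : (0 : ℝ) < (4 / 5) ^ j := by positivity
    nlinarith
  have hD : ∀ z, Q.half - dist z Q.center ≤ min t (infDist z Uᶜ) := fun z =>
    le_min (by linarith [dist_nonneg (x := z) (y := Q.center)]) (Cube.le_infDist_compl hU hQ)
  induction k generalizing x with
  | zero =>
    norm_num at hx ⊢
    rw [abs_sub_comm]
    refine hu _ (hQ (mem_closedBall_self hh.le)) _ (hmem (z := x) 1 (by norm_num; exact hx)) ?_
    have := hD Q.center
    rw [dist_self] at this
    rw [dist_comm]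
    linarith
  | succ k ih =>
    set p : ℝ := (4 / 5) ^ (k + 1) with hp
    have hp' : (4 / 5 : ℝ) ^ (k + 1 + 1) = 4 / 5 * p := by rw [hp]; ring
    have hp0 : 0 < p := by positivity
    have hp1 : p ≤ 1 := pow_le_one₀ (by norm_num) (by norm_num)
    have hxU := hmem _ hx
    rw [hp'] at hx
    set θ : ℝ := (1 - p) / (1 - 4 / 5 * p) with hθ
    have hden : 0 < 1 - 4 / 5 * p := by linarith
    have hθ0 : 0 ≤ θ := div_nonneg (by linarith) hden.le
    have hθe : θ * (1 - 4 / 5 * p) = 1 - p := div_mul_cancel₀ _ hden.ne'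
    have hθ1 : θ ≤ 1 := by rw [hθ, div_le_one hden]; linarith
    set y := AffineMap.lineMap Q.center x θ with hy
    have hy1 : dist y Q.center ≤ Q.half * (1 - p) := by
      rw [hy, dist_lineMap_left, Real.norm_of_nonneg hθ0, dist_comm Q.center x]
      calc θ * dist x Q.center ≤ θ * (Q.half * (1 - 4 / 5 * p)) := by gcongr
        _ = Q.half * (1 - p) := by rw [← hθe]; ring
    have hy2 : dist x y ≤ (Q.half * (4 / 5 * p)) / 4 := by
      rw [hy, dist_right_lineMap, Real.norm_of_nonneg (by linarith), dist_comm Q.center x]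
      calc (1 - θ) * dist x Q.center ≤ (1 - θ) * (Q.half * (1 - 4 / 5 * p)) :=
            mul_le_mul_of_nonneg_left hx (by linarith)
        _ = Q.half * ((1 - 4 / 5 * p) - θ * (1 - 4 / 5 * p)) := by ring
        _ = (Q.half * (4 / 5 * p)) / 4 := by rw [hθe]; ring
    have h1 := hu x hxU y (hmem _ hy1) (hy2.trans (by linarith [hD x]))
    have h2 := ih hy1
    have := abs_sub_le (u x) (u y) (u Q.center)
    push_cast
    linarith

theorem lintegral_sub_center_le (hu : CoarselyBloch U t κ u) (hκ : 0 < κ) (hU : Uᶜ.Nonempty)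
    {Q : Cube n} (hQ : Q.toSet ⊆ U) (hQt : Q.half ≤ t) :
    ∫⁻ x in Q.toSet, ENNReal.ofReal |u x - u Q.center| ≤
      ENNReal.ofReal (κ * (1 + 4 * n)) * volume Q.toSet := by
  have hh := Q.half_pos
  let B : ℕ → Set (Fin n → ℝ) := fun j =>
    Q.toSet \ closedBall Q.center (Q.half * (1 - (4 / 5) ^ (j + 1)))
  have hB : ∀ j, MeasurableSet (B j) := fun j =>
    Q.measurableSet_toSet.diff measurableSet_closedBall
  have hpoint : ∀ x ∈ Q.toSet, ENNReal.ofReal |u x - u Q.center| ≤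
      ENNReal.ofReal κ * (1 + ∑' j, (B j).indicator 1 x) := by
    intro x hx
    by_cases hex : ∃ k, x ∉ B k
    · classical
      have hk := Nat.find_spec hex
      set k := Nat.find hex with hkdef
      have hxk : dist x Q.center ≤ Q.half * (1 - (4 / 5) ^ (k + 1)) := by
        by_contra hcon
        exact hk ⟨hx, hcon⟩
      have hsum : (k : ENNReal) ≤ ∑' j, (B j).indicator (1 : (Fin n → ℝ) → ENNReal) x := by
        calc (k : ENNReal) = ∑ j ∈ Finset.range k, (B j).indicator 1 x := by
              rw [Finset.sum_congr rfl (g := fun _ => (1 : ENNReal))]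
              · simp
              · intro j hj
                have := Nat.find_min hex (Finset.mem_range.1 hj)
                rw [not_not] at this
                simp [this]
          _ ≤ _ := ENNReal.sum_le_tsum _
      calc ENNReal.ofReal |u x - u Q.center| ≤ ENNReal.ofReal ((k + 1) * κ) :=
            ENNReal.ofReal_le_ofReal (hu.abs_sub_center_le hU hQ hQt k hxk)
        _ = ENNReal.ofReal κ * (1 + k) := by
            rw [mul_comm, ENNReal.ofReal_mul hκ.le, ENNReal.ofReal_add (by positivity) one_pos.le,
              ENNReal.ofReal_natCast, ENNReal.ofReal_one, add_comm]
        _ ≤ _ := by gcongr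
    · push Not at hex
      have : ∑' j, (B j).indicator (1 : (Fin n → ℝ) → ENNReal) x = ⊤ := by
        simp only [Set.indicator_of_mem (hex _), Pi.one_apply]
        exact ENNReal.tsum_const_eq_top_of_ne_zero one_ne_zero
      rw [this, add_top, ENNReal.mul_top (by simpa using hκ)]
      exact le_top
  have hvol : ∀ j, volume (B j) ≤
      ENNReal.ofReal (n * (4 / 5) ^ (j + 1)) * volume Q.toSet := by
    intro j
    set p : ℝ := (4 / 5) ^ (j + 1) with hp
    have hp0 : 0 < p := by positivity
    have hp1 : p ≤ 1 := pow_le_one₀ (by norm_num) (by norm_num)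
    have hr : 0 ≤ Q.half * (1 - p) := mul_nonneg hh.le (by linarith)
    have hsub : closedBall Q.center (Q.half * (1 - p)) ⊆ Q.toSet :=
      closedBall_subset_closedBall (by nlinarith)
    rw [show volume (B j) = _ from measure_sdiff hsub measurableSet_closedBall.nullMeasurableSet
        (isCompact_closedBall _ _).measure_lt_top.ne,
      Q.volume_toSet, Real.volume_pi_closedBall _ hr, Fintype.card_fin,
      ← ENNReal.ofReal_sub _ (by positivity), ← ENNReal.ofReal_mul (by positivity)]
    apply ENNReal.ofReal_le_ofReal
    have hbern := one_add_mul_le_pow (a := -p) (by linarith) n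
    calc (2 * Q.half) ^ n - (2 * (Q.half * (1 - p))) ^ n
        = (2 * Q.half) ^ n * (1 - (1 + -p) ^ n) := by
          rw [← mul_assoc, mul_pow (2 * Q.half), sub_eq_add_neg (1 : ℝ) p]; ring
      _ ≤ (2 * Q.half) ^ n * (n * p) := by gcongr; linarith
      _ = _ := by ring
  have hgeom : ∑' j : ℕ, ENNReal.ofReal (n * (4 / 5) ^ (j + 1)) = ENNReal.ofReal (4 * n) := by
    have hs : HasSum (fun j : ℕ => (n : ℝ) * (4 / 5) ^ (j + 1)) (4 * n) := by
      have h := (hasSum_geometric_of_lt_one (r := (4 / 5 : ℝ)) (by norm_num)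
        (by norm_num)).mul_left ((n : ℝ) * (4 / 5))
      have h1 : (n : ℝ) * (4 / 5) * (1 - 4 / 5)⁻¹ = 4 * n := by norm_num; ring
      rw [h1] at h
      exact h.congr_fun fun j => by ring
    rw [← hs.tsum_eq, ENNReal.ofReal_tsum_of_nonneg (fun j => by positivity) hs.summable]
  calc ∫⁻ x in Q.toSet, ENNReal.ofReal |u x - u Q.center|
      ≤ ∫⁻ x in Q.toSet, ENNReal.ofReal κ * (1 + ∑' j, (B j).indicator 1 x) :=
        setLIntegral_mono' Q.measurableSet_toSet hpoint
    _ = ENNReal.ofReal κ * (volume Q.toSet + ∑' j, volume (B j)) := by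
        rw [lintegral_const_mul' _ _ ENNReal.ofReal_ne_top, lintegral_add_left measurable_const,
          lintegral_tsum fun j => (measurable_one.indicator (hB j)).aemeasurable]
        congr 2
        · simp
        · congr 1
          funext j
          rw [lintegral_indicator_one (hB j), Measure.restrict_apply (hB j),
            Set.inter_eq_left.2 Set.sdiff_subset]
    _ ≤ ENNReal.ofReal κ * (volume Q.toSet +
          ∑' j : ℕ, ENNReal.ofReal (n * (4 / 5) ^ (j + 1)) * volume Q.toSet) := by
        gcongr with j
        exact hvol j
    _ = _ := by
        rw [ENNReal.tsum_mul_right, hgeom, ENNReal.ofReal_mul hκ.le,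
          ENNReal.ofReal_add one_pos.le (by positivity), ENNReal.ofReal_one]
        ring

end CoarselyBloch

theorem infDist_compl_pos {U : Set (Fin n → ℝ)} (hU : IsOpen U) (hne : Uᶜ.Nonempty)
    {x : Fin n → ℝ} (hx : x ∈ U) : 0 < infDist x Uᶜ :=
  (hU.isClosed_compl.notMem_iff_infDist_pos hne).1 (fun h => h hx)

theorem closedBall_subset_of_lt_infDist_compl {U : Set (Fin n → ℝ)} {x : Fin n → ℝ} {r : ℝ}
    (h : r < infDist x Uᶜ) : closedBall x r ⊆ U :=
  (closedBall_subset_ball h).trans ball_infDist_compl_subset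

theorem infDist_frontier_le_infDist_compl {U : Set (Fin n → ℝ)} (hne : Uᶜ.Nonempty)
    {x : Fin n → ℝ} (hx : x ∈ U) : infDist x (frontier U) ≤ infDist x Uᶜ := by
  obtain ⟨y, hy, hxy⟩ := exists_mem_frontier_infDist_compl_eq_dist hx (Set.nonempty_compl.1 hne)
  rw [hxy]
  exact infDist_le_dist_of_mem hy

theorem IsEpsDeltaDomain.compl_nonempty {U : Set (Fin n → ℝ)} {ε δ : ℝ} (hn : 0 < n)
    (hε : 0 < ε) (hδ : 0 < δ) (h : IsEpsDeltaDomain U ε δ) : Uᶜ.Nonempty := by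
  rw [Set.nonempty_compl]
  rintro rfl
  have : Nonempty (Fin n) := ⟨⟨0, hn⟩⟩
  set y : Fin n → ℝ := fun _ => δ / 2 with hy
  have h0y : dist (0 : Fin n → ℝ) y = δ / 2 := by
    rw [dist_zero_left, hy, pi_norm_const, Real.norm_of_nonneg (by positivity)]
  obtain ⟨γ, hγ, h0, h1, -, -, hd⟩ := h 0 (Set.mem_univ _) y (Set.mem_univ _) (by linarith)
  have hcont : ContinuousOn (fun s => dist (γ s) 0) (Set.Icc 0 1) :=
    (continuous_id.dist continuous_const).comp_continuousOn hγ
  obtain ⟨s, hs, hs'⟩ := intermediate_value_Icc zero_le_one hcont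
    (show δ / 4 ∈ Set.Icc (dist (γ 0) 0) (dist (γ 1) 0) by
      rw [h0, h1, dist_self, dist_comm, h0y]; constructor <;> linarith)
  have hs2 := hd s hs
  have htri := dist_triangle_left (0 : Fin n → ℝ) y (γ s)
  simp only at hs'
  rw [frontier_univ, infDist_empty, hs', h0y] at hs2
  rw [h0y, hs'] at htri
  have : 0 < ε * (δ / 4 * dist (γ s) y) / (δ / 2) := by
    have : 0 < dist (γ s) y := by linarith
    positivity
  linarith

/-- A point at distance at least `s` from the complement of an `(ε, δ)`-domain can be joined, by a
chain of small steps and controlled total length that stays away from the complement, to a point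
whose distance to the complement is comparable to `δ`. -/
theorem IsEpsDeltaDomain.exists_chain {U : Set (Fin n → ℝ)} {ε δ : ℝ} (hε : 0 < ε) (hε1 : ε ≤ 1)
    (hδ : 0 < δ) (h : IsEpsDeltaDomain U ε δ) (hne : Uᶜ.Nonempty) {s η : ℝ} (hs : 0 < s)
    (hsδ : s ≤ δ / 4) (hη : 0 < η) (hηδ : η ≤ δ / 8) {x y : Fin n → ℝ} (hx : x ∈ U) (hy : y ∈ U)
    (hxy : dist x y = δ / 2) (hsx : s ≤ infDist x Uᶜ) :
    ∃ (m : ℕ) (p : ℕ → Fin n → ℝ), p 0 = x ∧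
      (∀ i ≤ m, p i ∈ U ∧ ε * s / 4 ≤ infDist (p i) Uᶜ) ∧
      (∀ i < m, dist (p i) (p (i + 1)) ≤ η) ∧
      ∑ i ∈ Finset.range m, dist (p i) (p (i + 1)) ≤ ε⁻¹ * (δ / 2) ∧
      ε * δ / 16 ≤ infDist (p m) Uᶜ := by
  classical
  obtain ⟨γ, hγ, h0, h1, hγU, hlen, hd⟩ := h x hx y hy (by linarith)
  rw [hxy] at hlen
  obtain ⟨θ, hθ, hunif⟩ := Metric.uniformContinuousOn_iff.1
    (isCompact_Icc.uniformContinuousOn_of_continuous hγ) η hη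
  obtain ⟨M, hM⟩ := exists_nat_gt θ⁻¹
  have hM0 : (0 : ℝ) < M := (inv_pos.2 hθ).trans hM
  set τ : ℕ → ℝ := fun i => min (i / M) 1 with hτ
  have hτmem : ∀ i, τ i ∈ Set.Icc (0 : ℝ) 1 := fun i =>
    ⟨le_min (by positivity) zero_le_one, min_le_right _ _⟩
  have hτmono : Monotone τ := fun i j hij => by
    have : (i : ℝ) ≤ j := by exact_mod_cast hij
    simp only [hτ]
    gcongr
  have hstep : ∀ i, dist (γ (τ i)) (γ (τ (i + 1))) ≤ η := by
    intro i
    refine (hunif _ (hτmem i) _ (hτmem (i + 1)) ?_).le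
    rw [Real.dist_eq]
    refine (abs_min_sub_min_le_max _ _ _ _).trans_lt ?_
    rw [sub_self, abs_zero, Nat.cast_add, Nat.cast_one, add_div, sub_add_cancel_left, abs_neg,
      abs_of_nonneg (by positivity), max_eq_left (by positivity)]
    rw [div_lt_iff₀ hM0]
    calc (1 : ℝ) = θ * θ⁻¹ := (mul_inv_cancel₀ hθ.ne').symm
      _ < θ * M := by gcongr
  have hD : ∀ i, ε * (dist (γ (τ i)) x * dist (γ (τ i)) y) / (δ / 2) ≤ infDist (γ (τ i)) Uᶜ :=
    fun i => by
      have := hd _ (hτmem i)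
      rw [hxy] at this
      exact this.trans (infDist_frontier_le_infDist_compl hne (hγU _ (hτmem i)))
  have hex : ∃ i, δ / 4 ≤ dist (γ (τ i)) x := by
    refine ⟨M, ?_⟩
    have : τ M = 1 := by simp [hτ, div_self hM0.ne']
    rw [this, h1, dist_comm, hxy]
    linarith
  have hm := Nat.find_spec hex
  have hmin : ∀ i < Nat.find hex, dist (γ (τ i)) x < δ / 4 := fun i hi =>
    not_le.1 (Nat.find_min hex hi)
  set m := Nat.find hex with hmdef
  have hτ0 : γ (τ 0) = x := by simp [hτ, h0]
  have hm0 : m ≠ 0 := by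
    intro hm0
    rw [hm0, hτ0, dist_self] at hm
    linarith
  have hend : ε * δ / 16 ≤ infDist (γ (τ m)) Uᶜ := by
    refine le_trans ?_ (hD m)
    obtain ⟨k, hk⟩ := Nat.exists_eq_succ_of_ne_zero hm0
    have h2 := hmin k (by omega)
    have h3 := hstep k
    rw [← Nat.succ_eq_add_one, ← hk] at h3
    have h4 := dist_triangle_left (γ (τ m)) x (γ (τ k))
    have h5 := dist_triangle_left x y (γ (τ m))
    have h6 : δ / 8 ≤ dist (γ (τ m)) y := by linarith
    rw [le_div_iff₀ (by positivity)]
    calc ε * δ / 16 * (δ / 2) = ε * (δ / 4 * (δ / 8)) := by ring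
      _ ≤ _ := by gcongr
  refine ⟨m, fun i => γ (τ i), hτ0, fun i hi => ⟨hγU _ (hτmem i), ?_⟩, fun i _ => hstep i, ?_, hend⟩
  · rcases hi.lt_or_eq with hi | rfl
    · have h2 := hmin i hi
      have h5 := dist_triangle_left x y (γ (τ i))
      rcases le_total (dist (γ (τ i)) x) (s / 2) with hle | hle
      · have h3 := infDist_le_infDist_add_dist (s := Uᶜ) (x := x) (y := γ (τ i))
        rw [dist_comm] at h3
        nlinarith
      · refine le_trans ?_ (hD i)
        rw [le_div_iff₀ (by positivity)]
        calc ε * s / 4 * (δ / 2) = ε * (s / 2 * (δ / 4)) := by ring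
          _ ≤ _ := by
            gcongr
            linarith
    · refine le_trans ?_ hend
      nlinarith
  · have h2 := eVariationOn.sum_le (f := γ) (n := m) hτmono hτmem
    rw [← ENNReal.ofReal_le_ofReal_iff (by positivity),
      ENNReal.ofReal_sum_of_nonneg fun _ _ => dist_nonneg]
    refine le_trans (le_of_eq ?_) (h2.trans hlen)
    exact Finset.sum_congr rfl fun i _ => by rw [edist_comm, edist_dist]

/-- The variation along a chain of a function which changes by at most `κ` at scale `η`. -/
theorem abs_sub_le_of_chain {E : Type*} [PseudoMetricSpace E] {u : E → ℝ} {p : ℕ → E} {m : ℕ}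
    {η κ : ℝ} (hη : 0 < η) (hκ : 0 ≤ κ) (hstep : ∀ i < m, dist (p i) (p (i + 1)) ≤ η / 2)
    (hu : ∀ i ≤ m, ∀ j ≤ m, dist (p i) (p j) ≤ η → |u (p i) - u (p j)| ≤ κ) :
    |u (p 0) - u (p m)| ≤
      κ * (2 / η * ∑ i ∈ Finset.range m, dist (p i) (p (i + 1))) + κ := by
  set S : ℕ → ℝ := fun k => ∑ i ∈ Finset.range k, dist (p i) (p (i + 1)) with hS
  have hSsucc : ∀ k, S (k + 1) = S k + dist (p k) (p (k + 1)) := fun k =>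
    Finset.sum_range_succ _ _
  have hdist : ∀ j k, j ≤ k → dist (p j) (p k) ≤ S k - S j := fun j k hjk => by
    rw [hS]
    simp only
    rw [← Finset.sum_Ico_eq_sub _ hjk]
    exact dist_le_Ico_sum_dist p hjk
  have key : ∀ k ≤ m, ∃ j ≤ k, |u (p 0) - u (p j)| ≤ κ * (2 / η * S j) ∧ S k - S j ≤ η / 2 := by
    intro k
    induction k with
    | zero => intro _; exact ⟨0, le_rfl, by simp [hS], by rw [sub_self]; positivity⟩
    | succ k ih =>
      intro hk
      obtain ⟨j, hjk, h1, h2⟩ := ih (by omega)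
      by_cases hcase : S (k + 1) - S j ≤ η / 2
      · exact ⟨j, by omega, h1, hcase⟩
      · push Not at hcase
        refine ⟨k + 1, le_rfl, ?_, by rw [sub_self]; positivity⟩
        have h3 := hstep k (by omega)
        have h4 := hu j (by omega) (k + 1) hk
          ((hdist j (k + 1) (by omega)).trans (by linarith [hSsucc k]))
        have h5 := abs_sub_le (u (p 0)) (u (p j)) (u (p (k + 1)))
        have h6 : 1 ≤ 2 / η * (S (k + 1) - S j) := by
          rw [div_mul_eq_mul_div, le_div_iff₀ hη]
          linarith
        have h7 : κ * 1 ≤ κ * (2 / η * (S (k + 1) - S j)) := by gcongr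
        linarith
  obtain ⟨j, hj, h1, h2⟩ := key m le_rfl
  have h3 := hu j hj m le_rfl ((hdist j m hj).trans (by linarith))
  have h4 := abs_sub_le (u (p 0)) (u (p j)) (u (p m))
  have h5 : S j ≤ S m := by linarith [hdist j m hj, dist_nonneg (x := p j) (y := p m)]
  have h6 : κ * (2 / η * S j) ≤ κ * (2 / η * S m) := by gcongr
  linarith

/-- The mean of `f` over the cube around `x` whose half-side is half the distance from `x` to the
complement of `U`, the latter being truncated at `t`. -/
def localMean (U : Set (Fin n → ℝ)) (t : ℝ) (f : (Fin n → ℝ) → ℝ) (x : Fin n → ℝ) : ℝ :=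
  ⨍ z in closedBall x (min t (infDist x Uᶜ) / 2), f z

section LocalMean

variable {U : Set (Fin n → ℝ)} {t κ : ℝ} {f : (Fin n → ℝ) → ℝ}

theorem localMean_coarselyBloch (hU : IsOpen U) (hne : Uᶜ.Nonempty) (ht : 0 < t)
    (hf : ∀ Q : Cube n, Q.toSet ⊆ U → IntegrableOn f Q.toSet)
    (hosc : ∀ Q : Cube n, Q.toSet ⊆ U → Q.half ≤ t → Q.osc f ≤ κ) :
    CoarselyBloch U t (2 * 3 ^ n * κ) (localMean U t f) := by
  intro x hx y hy hxy
  have hDx := infDist_compl_pos hU hne hx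
  have hDy := infDist_compl_pos hU hne hy
  have hr : 0 < min t (infDist x Uᶜ) := lt_min ht hDx
  have hs : 0 < min t (infDist y Uᶜ) := lt_min ht hDy
  have hrs : |min t (infDist x Uᶜ) - min t (infDist y Uᶜ)| ≤ dist x y := by
    refine (abs_min_sub_min_le_max _ _ _ _).trans ?_
    rw [sub_self, abs_zero]
    refine max_le dist_nonneg ?_
    simpa [Real.dist_eq] using (lipschitz_infDist_pt Uᶜ).dist_le_mul x y
  have hrD : min t (infDist x Uᶜ) ≤ infDist x Uᶜ := min_le_right _ _
  have hrt : min t (infDist x Uᶜ) ≤ t := min_le_left _ _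
  set r := min t (infDist x Uᶜ) with hrdef
  set s := min t (infDist y Uᶜ) with hsdef
  rw [abs_le] at hrs
  let Q : Cube n := ⟨x, 7 / 8 * r, by positivity⟩
  let P : Cube n := ⟨x, r / 2, by positivity⟩
  let P' : Cube n := ⟨y, s / 2, by positivity⟩
  have hQU : Q.toSet ⊆ U :=
    closedBall_subset_of_lt_infDist_compl (show 7 / 8 * r < infDist x Uᶜ by linarith)
  have hP : P.toSet ⊆ Q.toSet :=
    closedBall_subset_closedBall (show r / 2 ≤ 7 / 8 * r by linarith)
  have hP' : P'.toSet ⊆ Q.toSet :=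
    closedBall_subset_closedBall' (show s / 2 + dist y x ≤ 7 / 8 * r by
      rw [dist_comm]; linarith)
  have hQosc := hosc Q hQU (show 7 / 8 * r ≤ t by linarith)
  have hQ0 := Q.osc_nonneg f
  have h1 := Cube.abs_avg_sub_avg_le Q P hP (hf Q hQU)
  have h2 := Cube.abs_avg_sub_avg_le Q P' hP' (hf Q hQU)
  have h3 : (Q.half / P.half) ^ n * Q.osc f ≤ 3 ^ n * κ := by
    gcongr
    show 7 / 8 * r / (r / 2) ≤ 3
    rw [div_le_iff₀ (by positivity)]
    linarith
  have h4 : (Q.half / P'.half) ^ n * Q.osc f ≤ 3 ^ n * κ := by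
    have : Q.half / P'.half ≤ 3 := by
      show 7 / 8 * r / (s / 2) ≤ 3
      rw [div_le_iff₀ (by positivity)]
      linarith
    have h0 : 0 ≤ Q.half / P'.half := (div_pos Q.half_pos P'.half_pos).le
    gcongr
  have h5 := abs_sub_le (P.avg f) (Q.avg f) (P'.avg f)
  rw [abs_sub_comm (Q.avg f)] at h5
  show |P.avg f - P'.avg f| ≤ _
  linarith

theorem abs_avg_sub_localMean_le (hne : Uᶜ.Nonempty) (ht : 0 < t)
    (hf : ∀ Q : Cube n, Q.toSet ⊆ U → IntegrableOn f Q.toSet)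
    (hosc : ∀ Q : Cube n, Q.toSet ⊆ U → Q.half ≤ t → Q.osc f ≤ κ) {Q : Cube n} (hQ : Q.toSet ⊆ U)
    (htQ : t / 2 ≤ Q.half) (hQt : Q.half ≤ t) :
    |Q.avg f - localMean U t f Q.center| ≤ 4 ^ n * κ := by
  have hQD := le_infDist_compl hne hQ
  have hQ0 := Q.half_pos
  have hr1 : t / 2 ≤ min t (infDist Q.center Uᶜ) := le_min (by linarith) (by linarith)
  have hr2 : min t (infDist Q.center Uᶜ) ≤ t := min_le_left _ _
  let P : Cube n := ⟨Q.center, min t (infDist Q.center Uᶜ) / 2, by linarith⟩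
  have hP : P.toSet ⊆ Q.toSet := closedBall_subset_closedBall
    (show min t (infDist Q.center Uᶜ) / 2 ≤ Q.half by linarith)
  have h := Cube.abs_avg_sub_avg_le Q P hP (hf Q hQ)
  rw [abs_sub_comm]
  refine h.trans ?_
  have h4 : Q.half / P.half ≤ 4 := by
    rw [div_le_iff₀ P.half_pos]
    show Q.half ≤ 4 * (min t (infDist Q.center Uᶜ) / 2)
    linarith
  have h0 : 0 ≤ Q.half / P.half := (div_pos Q.half_pos P.half_pos).le
  have := Q.osc_nonneg f
  have := hosc Q hQ hQt
  gcongr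

end LocalMean

theorem CoarselyBloch.exists_bound_of_isBounded {U : Set (Fin n → ℝ)} {t κ s : ℝ}
    {u : (Fin n → ℝ) → ℝ} (hu : CoarselyBloch U t κ u) (hU : Bornology.IsBounded U) (ht : 0 < t)
    (hs : 0 < s) : ∃ K, ∀ x ∈ U, s ≤ infDist x Uᶜ → |u x| ≤ K := by
  have hAU : {x | s ≤ infDist x Uᶜ} ⊆ U := by
    intro x hx
    by_contra hxU
    have : infDist x Uᶜ = 0 := infDist_zero_of_mem hxU
    simp only [Set.mem_ofPred_eq] at hx
    linarith
  have hA : IsCompact {x | s ≤ infDist x Uᶜ} :=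
    isCompact_of_isClosed_isBounded
      (isClosed_le continuous_const (continuous_infDist_pt _)) (hU.subset hAU)
  obtain ⟨K, hK⟩ : ∃ K, ∀ x ∈ {x | s ≤ infDist x Uᶜ}, s ≤ infDist x Uᶜ → |u x| ≤ K := by
    refine hA.induction_on (p := fun S => ∃ K, ∀ x ∈ S, s ≤ infDist x Uᶜ → |u x| ≤ K) ?_ ?_ ?_ ?_
    · exact ⟨0, by simp⟩
    · rintro S T hST ⟨K, hK⟩
      exact ⟨K, fun x hx => hK x (hST hx)⟩
    · rintro S T ⟨K, hK⟩ ⟨L, hL⟩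
      exact ⟨max K L, fun x hx hsx => hx.elim (fun h => (hK x h hsx).trans (le_max_left _ _))
        fun h => (hL x h hsx).trans (le_max_right _ _)⟩
    · intro x hx
      have hr : 0 < min t s / 4 := by positivity
      refine ⟨_, mem_nhdsWithin_of_mem_nhds (closedBall_mem_nhds x hr), |u x| + κ, ?_⟩
      intro y hy hsy
      have h1 := hu y (hAU hsy) x (hAU hx) ((mem_closedBall.1 hy).trans (by gcongr))
      have h2 := abs_sub_abs_le_abs_sub (u y) (u x)
      linarith
  exact ⟨K, fun x _ hx => hK x hx hx⟩

theorem exists_bound_localMean {U : Set (Fin n → ℝ)} {ε δ : ℝ} (hε : 0 < ε) (hε1 : ε ≤ 1)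
    (hδ : 0 < δ) (hUd : IsRealDomain U) (hed : IsEpsDeltaDomain U ε δ) (hne : Uᶜ.Nonempty)
    {t κ B : ℝ} {f : (Fin n → ℝ) → ℝ} (ht : 0 < t) (htδ : t ≤ ε * δ / 16) (hκ : 0 ≤ κ)
    (hf : ∀ Q : Cube n, Q.toSet ⊆ U → IntegrableOn f Q.toSet)
    (hB : ∀ Q : Cube n, Q.toSet ⊆ U → ε * δ / 16 ≤ Q.side → Q.avgAbs f ≤ B)
    (hcb : CoarselyBloch U t κ (localMean U t f)) :
    ∃ K, ∀ x ∈ U, t / 2 ≤ infDist x Uᶜ → |localMean U t f x| ≤ K := by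
  by_cases hbdd : Bornology.IsBounded U
  · exact hcb.exists_bound_of_isBounded hbdd ht (by positivity)
  set R : ℝ := ε * δ / 32 with hR
  set η : ℝ := ε * t / 32 with hη
  have hεδ : ε * δ ≤ δ := mul_le_of_le_one_left hδ.le hε1
  have hεt : ε * t ≤ t := mul_le_of_le_one_left ht.le hε1
  have hη0 : 0 < η := by positivity
  refine ⟨(R / (t / 2)) ^ n * B + (κ * (2 / η * (ε⁻¹ * (δ / 2))) + κ), fun x hx htx => ?_⟩
  obtain ⟨y, hy, hxy⟩ : ∃ y ∈ U, dist x y = δ / 2 := by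
    obtain ⟨z, hz, hxz⟩ : ∃ z ∈ U, δ / 2 ≤ dist x z := by
      by_contra! hcon
      exact hbdd (isBounded_closedBall.subset fun z hz =>
        mem_closedBall'.2 (hcon z hz).le)
    exact hUd.2.isPreconnected.intermediate_value hx hz
      (f := fun z => dist x z) (by fun_prop) ⟨by simp; positivity, hxz⟩
  obtain ⟨m, p, hp0, hp, hstep, hlen, hend⟩ := hed.exists_chain hε hε1 hδ hne
    (s := t / 2) (η := η / 2) (by positivity) (by linarith) (by positivity) (by linarith) hx hy hxy
    htx
  have h1 := abs_sub_le_of_chain (u := localMean U t f) hη0 hκ hstep fun i hi j hj hij =>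
    hcb _ (hp i hi).1 _ (hp j hj).1 (hij.trans (by
      have : ε * t / 8 ≤ min t (infDist (p i) Uᶜ) :=
        le_min (by linarith) (by linarith [(hp i hi).2])
      linarith))
  rw [hp0] at h1
  have h2 : κ * (2 / η * ∑ i ∈ Finset.range m, dist (p i) (p (i + 1))) ≤
      κ * (2 / η * (ε⁻¹ * (δ / 2))) := by gcongr
  have h3 : |localMean U t f (p m)| ≤ (R / (t / 2)) ^ n * B := by
    have hR0 : 0 < R := by positivity
    let Q : Cube n := ⟨p m, R, hR0⟩
    let P : Cube n := ⟨p m, t / 2, by positivity⟩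
    have hQ : Q.toSet ⊆ U :=
      closedBall_subset_of_lt_infDist_compl (show R < infDist (p m) Uᶜ by linarith)
    have hPQ : P.toSet ⊆ Q.toSet :=
      closedBall_subset_closedBall (show t / 2 ≤ R by linarith)
    have h4 := Cube.abs_avg_sub_le Q P hPQ (hf Q hQ) 0
    have h5 : localMean U t f (p m) = P.avg f := by
      rw [localMean, min_eq_left (htδ.trans hend)]
      rfl
    simp only [sub_zero] at h4
    rw [h5]
    refine h4.trans ?_
    have := hB Q hQ (show ε * δ / 16 ≤ 2 * R by linarith)
    exact mul_le_mul_of_nonneg_left this (by positivity)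
  have h6 := abs_sub_abs_le_abs_sub (localMean U t f x) (localMean U t f (p m))
  linarith

protected theorem CoarselyBloch.const {U : Set (Fin n → ℝ)} {t κ : ℝ} (hκ : 0 ≤ κ) (a : ℝ) :
    CoarselyBloch U t κ fun _ => a := by
  intro x _ y _ _
  simpa using hκ

theorem coarselyBloch_log_infDist {U : Set (Fin n → ℝ)} (hU : IsOpen U) (hne : Uᶜ.Nonempty)
    {κ : ℝ} (hκ : 0 ≤ κ) (t a : ℝ) :
    CoarselyBloch U t κ fun x => κ * (Real.log (infDist x Uᶜ) - a) := by
  intro x hx y hy hxy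
  have hDx := infDist_compl_pos hU hne hx
  have hDy := infDist_compl_pos hU hne hy
  have h1 : dist x y ≤ infDist x Uᶜ / 4 := hxy.trans (by gcongr; exact min_le_right _ _)
  have h2 := infDist_le_infDist_add_dist (s := Uᶜ) (x := x) (y := y)
  have h3 := infDist_le_infDist_add_dist (s := Uᶜ) (x := y) (y := x)
  rw [dist_comm y x] at h3
  rw [← mul_sub, sub_sub_sub_cancel_right, abs_mul, abs_of_nonneg hκ,
    ← Real.log_div hDx.ne' hDy.ne']
  refine mul_le_of_le_one_right hκ (abs_le.2 ⟨?_, ?_⟩)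
  · have h4 := Real.log_le_sub_one_of_pos (div_pos hDy hDx)
    have h5 : infDist y Uᶜ / infDist x Uᶜ ≤ 2 := by
      rw [div_le_iff₀ hDx]
      linarith
    rw [← inv_div, Real.log_inv]
    linarith
  · have h4 := Real.log_le_sub_one_of_pos (div_pos hDx hDy)
    have h5 : infDist x Uᶜ / infDist y Uᶜ ≤ 2 := by
      rw [div_le_iff₀ hDy]
      linarith
    linarith

/-- A coarsely Bloch function can be made bounded, and zero near the complement, without losing
the coarse Bloch bound and without changing it far from the complement. -/
theorem CoarselyBloch.exists_truncation {U : Set (Fin n → ℝ)} (hU : IsOpen U) (hne : Uᶜ.Nonempty)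
    {t κ K s : ℝ} {u : (Fin n → ℝ) → ℝ} (hu : CoarselyBloch U t κ u) (hκ : 0 < κ) (hs : 0 < s)
    (hK0 : 0 ≤ K) (hK : ∀ x ∈ U, s ≤ infDist x Uᶜ → |u x| ≤ K) :
    ∃ (g : (Fin n → ℝ) → ℝ) (τ : ℝ), 0 < τ ∧ CoarselyBloch U t κ g ∧ (∀ x, |g x| ≤ K) ∧
      (∀ x ∈ U, s ≤ infDist x Uᶜ → g x = u x) ∧ ∀ x ∈ U, infDist x Uᶜ < τ → g x = 0 := by
  set a : ℝ := Real.log s - K / κ with ha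
  set m : (Fin n → ℝ) → ℝ := fun x => min K (max (κ * (Real.log (infDist x Uᶜ) - a)) 0) with hm
  have hmcb : CoarselyBloch U t κ m :=
    (CoarselyBloch.const hκ.le K).min
      ((coarselyBloch_log_infDist hU hne hκ.le t a).max (CoarselyBloch.const hκ.le 0))
  have hm0 : ∀ x, 0 ≤ m x := fun x => le_min hK0 (le_max_right _ _)
  refine ⟨fun x => max (-m x) (min (u x) (m x)), Real.exp a, Real.exp_pos _,
    hmcb.neg.max (hu.min hmcb), fun x => ?_, fun x hx hsx => ?_, fun x hx hxτ => ?_⟩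
  · have hmK : m x ≤ K := min_le_left _ _
    rw [abs_le]
    exact ⟨(neg_le_neg hmK).trans (le_max_left _ _),
      max_le ((neg_nonpos.2 (hm0 x)).trans hK0) ((min_le_right _ _).trans hmK)⟩
  · have hmx : m x = K := by
      refine min_eq_left (le_max_of_le_left ?_)
      have hlog := Real.log_le_log hs hsx
      calc K = κ * (Real.log s - a) := by rw [ha]; field_simp; ring
        _ ≤ _ := by gcongr
    have h := abs_le.1 (hK x hx hsx)
    simp only [hmx]
    rw [min_eq_left h.2, max_eq_right h.1]
  · have hDx := infDist_compl_pos hU hne hx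
    have hmx : m x = 0 := by
      have hlog : Real.log (infDist x Uᶜ) < a := (Real.log_lt_iff_lt_exp hDx).2 hxτ
      have : κ * (Real.log (infDist x Uᶜ) - a) ≤ 0 :=
        mul_nonpos_of_nonneg_of_nonpos hκ.le (by linarith)
      simp only [hm]
      rw [max_eq_right this, min_eq_right hK0]
    simp only [hmx]
    rw [neg_zero, max_eq_left (min_le_right _ _)]

/-- A bounded function that changes by at most `κ` at some scale is within `κ` of a Lipschitz
function. -/
theorem exists_lipschitzWith_near {E : Type*} [PseudoMetricSpace E] {U : Set E} {g : E → ℝ}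
    {K κ η : ℝ} (hη : 0 < η) (hne : U.Nonempty) (hκ : 0 ≤ κ) (hK : ∀ x ∈ U, |g x| ≤ K)
    (hg : ∀ x ∈ U, ∀ y ∈ U, dist x y ≤ η → |g x - g y| ≤ κ) :
    ∃ (G : E → ℝ) (C : NNReal), LipschitzWith C G ∧ ∀ x ∈ U, g x ≤ G x ∧ G x ≤ g x + κ := by
  have : Nonempty U := hne.to_subtype
  have hK0 : 0 ≤ K := (abs_nonneg _).trans (hK _ hne.some_mem)
  set Λ : ℝ := 2 * K / η with hΛ
  have hΛ0 : 0 ≤ Λ := by positivity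
  have hbdd : ∀ x : E, BddAbove (Set.range fun y : U => g y - Λ * dist x y) := by
    refine fun x => ⟨K, ?_⟩
    rintro _ ⟨y, rfl⟩
    have := (abs_le.1 (hK y y.2)).2
    have : 0 ≤ Λ * dist x y := by positivity
    simp only
    linarith
  refine ⟨fun x => ⨆ y : U, (g y - Λ * dist x (y : E)), Λ.toNNReal,
    LipschitzWith.of_le_add_mul _ fun x y => ciSup_le fun z => ?_, fun x hx => ⟨?_, ?_⟩⟩
  · have h1 := le_ciSup (hbdd y) z
    have h2 : Λ * dist y z ≤ Λ * (dist x y + dist x z) := by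
      gcongr
      exact dist_triangle_left _ _ _
    rw [Real.coe_toNNReal _ hΛ0]
    linarith
  · simpa using le_ciSup (hbdd x) ⟨x, hx⟩
  · refine ciSup_le fun y => ?_
    have hxK := abs_le.1 (hK x hx)
    have hyK := abs_le.1 (hK y y.2)
    rcases le_total (dist x y) η with hxy | hxy
    · have h1 := abs_le.1 (hg x hx y y.2 hxy)
      have h2 : 0 ≤ Λ * dist x y := by positivity
      linarith
    · have h1 : Λ * η ≤ Λ * dist x y := by gcongr
      have h2 : Λ * η = 2 * K := by rw [hΛ]; field_simp
      linarith

theorem exists_boundedOn_lipschitzOn_near {U : Set (Fin n → ℝ)} {g : (Fin n → ℝ) → ℝ}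
    {K κ η : ℝ} (hη : 0 < η) (hne : U.Nonempty) (hκ : 0 ≤ κ) (hK : ∀ x ∈ U, |g x| ≤ K)
    (hg : ∀ x ∈ U, ∀ y ∈ U, dist x y ≤ η → |g x - g y| ≤ κ) :
    ∃ G : (Fin n → ℝ) → ℝ, BoundedOn U G ∧ LipschitzOn U G ∧
      (∀ x ∈ Function.support G, x ∈ U ∧ g x ≠ 0) ∧ ∀ x ∈ U, |G x - g x| ≤ 2 * κ := by
  obtain ⟨G, C, hG, hGg⟩ := exists_lipschitzWith_near hη hne hκ hK hg
  set S : (Fin n → ℝ) → ℝ := fun x => G x - max (-κ) (min (G x) κ) with hS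
  have hSg : ∀ x ∈ U, |S x - g x| ≤ 2 * κ := by
    intro x hx
    have h1 : -κ ≤ max (-κ) (min (G x) κ) := le_max_left _ _
    have h2 : max (-κ) (min (G x) κ) ≤ κ := max_le (by linarith) (min_le_right _ _)
    have h3 := hGg x hx
    rw [abs_le]
    constructor <;> simp only [hS] <;> linarith
  have hind : ∀ x ∈ U, U.indicator S x = S x := fun x hx => Set.indicator_of_mem hx S
  refine ⟨U.indicator S, ⟨K + 2 * κ, fun x hx => ?_⟩, ⟨C + C, ?_⟩, fun x hx => ?_,
    fun x hx => by rw [hind x hx]; exact hSg x hx⟩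
  · rw [hind x hx]
    have h1 := abs_sub_abs_le_abs_sub (S x) (g x)
    have h2 := hSg x hx
    have h3 := hK x hx
    linarith
  · have hSL : LipschitzWith (C + C) S := hG.sub ((hG.min_const κ).const_max (-κ))
    intro x hx y hy
    rw [hind x hx, hind y hy]
    exact hSL x y
  · have hxU : x ∈ U := Set.mem_of_indicator_ne_zero hx
    refine ⟨hxU, fun h0 => hx ?_⟩
    have h3 := hGg x hxU
    rw [h0, zero_add] at h3
    rw [hind x hxU]
    simp only [hS]
    rw [min_eq_left h3.2, max_eq_right (by linarith), sub_self]

theorem lamED_pos (hn : 0 < n) {ε δ : ℝ} (hε : 0 < ε) (hδ : 0 < δ) : 0 < lamED n ε δ := by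
  have : (0 : ℝ) < n := Nat.cast_pos.2 hn
  unfold lamED
  positivity

theorem lamED_le (hn : 0 < n) {ε δ : ℝ} (hε : 0 < ε) (hε1 : ε ≤ 1) (hδ : 0 < δ) :
    lamED n ε δ ≤ ε * δ / 16 := by
  have hn1 : (1 : ℝ) ≤ n := Nat.one_le_cast.2 hn
  have h1 : (1 : ℝ) ≤ 1 + Real.sqrt n * ε := by
    have : 0 ≤ Real.sqrt n * ε := by positivity
    linarith
  have h2 : (1 : ℝ) ≤ n * (1 + Real.sqrt n * ε) := one_le_mul_of_one_le_of_one_le hn1 h1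
  have h3 : ε ^ 2 * δ ≤ ε * δ := by
    have := mul_le_of_le_one_left (mul_pos hε hδ).le hε1
    linarith
  have h4 : 0 < ε * δ := mul_pos hε hδ
  unfold lamED
  rw [mul_assoc 320, div_le_div_iff₀ (by linarith) (by norm_num)]
  have h5 : ε * δ * 1 ≤ ε * δ * (n * (1 + Real.sqrt n * ε)) := by gcongr
  linarith

theorem LipschitzOn.integrableOn {U : Set (Fin n → ℝ)} {g : (Fin n → ℝ) → ℝ}
    (hg : LipschitzOn U g) {Q : Cube n} (hQ : Q.toSet ⊆ U) : IntegrableOn g Q.toSet := by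
  obtain ⟨L, hL⟩ := hg
  exact (hL.continuousOn.mono hQ).integrableOn_compact Q.isCompact_toSet

theorem MemBmo.osc_le_omegaOn {U : Set (Fin n → ℝ)} {lam t : ℝ} {f : (Fin n → ℝ) → ℝ}
    (hf : MemBmo U lam f) (ht : t ≤ lam) {Q : Cube n} (hQ : Q.toSet ⊆ U) (hQt : Q.side < t) :
    Q.osc f ≤ omegaOn U f t := by
  refine le_csSup (hf.2.1.mono ?_) ⟨Q, hQ, hQt, rfl⟩
  rintro _ ⟨P, hP, hPt, rfl⟩
  exact ⟨P, hP, hPt.trans_le ht, rfl⟩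

theorem omegaOn_nonneg (U : Set (Fin n → ℝ)) (f : (Fin n → ℝ) → ℝ) (t : ℝ) : 0 ≤ omegaOn U f t := by
  refine Real.sSup_nonneg ?_
  rintro _ ⟨Q, -, -, rfl⟩
  exact Q.osc_nonneg f

theorem bigAvgSup_nonneg (U : Set (Fin n → ℝ)) (lam : ℝ) (f : (Fin n → ℝ) → ℝ) :
    0 ≤ bigAvgSup U lam f := by
  refine Real.sSup_nonneg ?_
  rintro _ ⟨Q, -, -, rfl⟩
  exact Q.average_abs_nonneg f

theorem bmoNorm_nonneg (U : Set (Fin n → ℝ)) (lam : ℝ) (f : (Fin n → ℝ) → ℝ) :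
    0 ≤ bmoNorm U lam f :=
  add_nonneg (omegaOn_nonneg U f lam) (bigAvgSup_nonneg U lam f)

theorem CoarselyBloch.lintegral_sub_sub_le {U : Set (Fin n → ℝ)} {t κ κ' E v : ℝ}
    {f g G : (Fin n → ℝ) → ℝ} (hg : CoarselyBloch U t κ' g) (hκ : 0 ≤ κ) (hκ' : 0 < κ')
    (hE : 0 ≤ E) (hne : Uᶜ.Nonempty) (hG : ∀ x ∈ U, |G x - g x| ≤ 2 * κ') {P : Cube n}
    (hP : P.toSet ⊆ U) (hPt : P.half ≤ t) (hf : IntegrableOn f P.toSet) (hosc : P.osc f ≤ κ)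
    (hv : |P.avg f - g P.center - v| ≤ E) :
    ∫⁻ x in P.toSet, ENNReal.ofReal |f x - G x - v| ≤
      ENNReal.ofReal (κ + κ' * (1 + 4 * n) + (2 * κ' + E)) * volume P.toSet := by
  have hfm : IntegrableOn (fun x => f x - P.avg f) P.toSet := P.integrableOn_sub_const hf _
  have h1 := (P.average_abs_le_iff hfm hκ).1 hosc
  have h2 := hg.lintegral_sub_center_le hκ' hne hP hPt
  calc ∫⁻ x in P.toSet, ENNReal.ofReal |f x - G x - v|
      ≤ ∫⁻ x in P.toSet, (ENNReal.ofReal |f x - P.avg f| + (ENNReal.ofReal |g x - g P.center| +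
          ENNReal.ofReal (2 * κ' + E))) := by
        refine setLIntegral_mono' P.measurableSet_toSet fun x hx => ?_
        rw [← ENNReal.ofReal_add (abs_nonneg _) (by positivity),
          ← ENNReal.ofReal_add (abs_nonneg _) (by positivity)]
        refine ENNReal.ofReal_le_ofReal ?_
        have h3 := abs_le.1 (hG x (hP hx))
        have h4 := abs_le.1 hv
        have h5 := neg_abs_le (f x - P.avg f)
        have h6 := le_abs_self (f x - P.avg f)
        have h7 := neg_abs_le (g x - g P.center)
        have h8 := le_abs_self (g x - g P.center)
        rw [abs_le]
        constructor <;> linarith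
    _ = (∫⁻ x in P.toSet, ENNReal.ofReal |f x - P.avg f|) +
          ((∫⁻ x in P.toSet, ENNReal.ofReal |g x - g P.center|) +
            ENNReal.ofReal (2 * κ' + E) * volume P.toSet) := by
        rw [lintegral_add_left' hfm.abs.aestronglyMeasurable.aemeasurable.ennreal_ofReal,
          lintegral_add_right _ measurable_const, setLIntegral_const]
    _ ≤ ENNReal.ofReal κ * volume P.toSet + (ENNReal.ofReal (κ' * (1 + 4 * n)) * volume P.toSet +
          ENNReal.ofReal (2 * κ' + E) * volume P.toSet) := by gcongr
    _ = _ := by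
        rw [← add_mul, ← add_mul, ← ENNReal.ofReal_add (by positivity) (by positivity),
          ← ENNReal.ofReal_add hκ (by positivity), add_assoc]

/-- The bound for the distance in the nonhomogeneous norm: oscillations over all cubes, and means
over cubes that are not too small. -/
theorem bmoNorm_sub_le {U : Set (Fin n → ℝ)} {t lam κ κ' E : ℝ} {f g G : (Fin n → ℝ) → ℝ}
    (ht : 0 < t) (htl : 2 * t < lam) (hg : CoarselyBloch U t κ' g) (hκ : 0 ≤ κ) (hκ' : 0 < κ')
    (hE : 0 ≤ E) (hne : Uᶜ.Nonempty) (hG : ∀ x ∈ U, |G x - g x| ≤ 2 * κ')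
    (hf : ∀ Q : Cube n, Q.toSet ⊆ U → IntegrableOn f Q.toSet)
    (hGi : ∀ Q : Cube n, Q.toSet ⊆ U → IntegrableOn G Q.toSet)
    (hosc : ∀ Q : Cube n, Q.toSet ⊆ U → Q.half ≤ t → Q.osc f ≤ κ)
    (hfg : ∀ Q : Cube n, Q.toSet ⊆ U → t / 2 ≤ Q.half → Q.half ≤ t →
      |Q.avg f - g Q.center| ≤ E) :
    bmoNorm U lam (f - G) ≤ 3 * (κ + κ' * (1 + 4 * n) + (2 * κ' + E)) := by
  set M : ℝ := κ + κ' * (1 + 4 * n) + (2 * κ' + E) with hM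
  have hM0 : 0 ≤ M := by positivity
  have hbig : ∀ Q : Cube n, Q.toSet ⊆ U → t < Q.half → ⨍ x in Q.toSet, |(f - G) x| ≤ M := by
    intro Q hQ htQ
    refine (Q.average_abs_le_iff ((hf Q hQ).sub (hGi Q hQ)) hM0).2 ?_
    refine Q.lintegral_le_of_subcubes ht htQ _ _ fun P hPQ h1 h2 => ?_
    have hP := hPQ.trans hQ
    have := hg.lintegral_sub_sub_le (v := 0) hκ hκ' hE hne hG hP h2 (hf P hP) (hosc P hP h2)
      (by simpa using hfg P hP h1 h2)
    simp only [sub_zero] at this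
    exact this
  have hoscle : ∀ Q : Cube n, Q.toSet ⊆ U → Q.osc (f - G) ≤ 2 * M := by
    intro Q hQ
    have hi : IntegrableOn (f - G) Q.toSet := (hf Q hQ).sub (hGi Q hQ)
    rcases lt_or_ge t Q.half with h | h
    · have h1 := Q.osc_le_two_mul hi 0
      have h2 := hbig Q hQ h
      simp only [sub_zero] at h1
      linarith
    · have h1 := Q.osc_le_two_mul hi (Q.avg f - g Q.center)
      have h2 := (Q.average_abs_le_iff (Q.integrableOn_sub_const hi (Q.avg f - g Q.center)) hM0).2
        (hg.lintegral_sub_sub_le hκ hκ' hE hne hG hQ h (hf Q hQ) (hosc Q hQ h)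
          (by rw [sub_self, abs_zero]; exact hE))
      linarith
  have h1 : omegaOn U (f - G) lam ≤ 2 * M := by
    refine Real.sSup_le ?_ (by positivity)
    rintro _ ⟨Q, hQ, -, rfl⟩
    exact hoscle Q hQ
  have h2 : bigAvgSup U lam (f - G) ≤ M := by
    refine Real.sSup_le ?_ hM0
    rintro _ ⟨Q, hQ, hl, rfl⟩
    unfold Cube.side at hl
    exact hbig Q hQ (by linarith)
  unfold bmoNorm
  linarith

theorem VanishSmallOsc.exists_bmoNorm_sub_le (hn : 0 < n) {ε δ : ℝ} (hε : 0 < ε) (hε1 : ε ≤ 1)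
    (hδ : 0 < δ) {U : Set (Fin n → ℝ)} (hUd : IsRealDomain U) (hed : IsEpsDeltaDomain U ε δ)
    {f : (Fin n → ℝ) → ℝ} (hf : MemBmo U (lamED n ε δ) f) (hv : VanishSmallOsc U f) {κ : ℝ}
    (hκ : 0 < κ) :
    ∃ G : (Fin n → ℝ) → ℝ, (BoundedOn U G ∧ LipschitzOn U G ∧ SuppAway U G) ∧
      bmoNorm U (lamED n ε δ) (f - G) ≤
        3 * (κ + 2 * 3 ^ n * κ * (1 + 4 * n) + (2 * (2 * 3 ^ n * κ) + 4 ^ n * κ)) := by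
  have hl := lamED_pos hn hε hδ
  have hl2 := lamED_le hn hε hε1 hδ
  have hne := hed.compl_nonempty hn hε hδ
  set lam := lamED n ε δ with hlam
  obtain ⟨T, hTκ, hT0, hTl⟩ :=
    ((hv.eventually (gt_mem_nhds hκ)).and (Ioc_mem_nhdsGT hl)).exists
  set t : ℝ := T / 4 with ht
  have ht0 : 0 < t := by positivity
  have hosc : ∀ Q : Cube n, Q.toSet ⊆ U → Q.half ≤ t → Q.osc f ≤ κ := fun Q hQ hQt =>
    (hf.osc_le_omegaOn hTl hQ (show 2 * Q.half < T by linarith)).trans hTκ.le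
  have hcb := localMean_coarselyBloch hUd.1 hne ht0 hf.1 hosc
  obtain ⟨B, hB⟩ := hf.2.2
  obtain ⟨K, hK⟩ := exists_bound_localMean hε hε1 hδ hUd hed hne ht0 (by linarith) (by positivity)
    hf.1 (fun Q hQ hs => hB ⟨Q, hQ, hl2.trans hs, rfl⟩) hcb
  have hκ' : 0 < 2 * 3 ^ n * κ := by positivity
  obtain ⟨g, τ, hτ, hg, hgK, hgu, hg0⟩ := hcb.exists_truncation hUd.1 hne hκ'
    (half_pos ht0) (le_max_right K 0) fun x hx hD => (hK x hx hD).trans (le_max_left _ _)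
  have hgη : ∀ x ∈ U, ∀ y ∈ U, dist x y ≤ min t τ / 4 → |g x - g y| ≤ 2 * 3 ^ n * κ := by
    intro x hx y hy hxy
    have hm : ∀ z, τ ≤ infDist z Uᶜ → min t τ / 4 ≤ min t (infDist z Uᶜ) / 4 := fun z hz => by
      gcongr
    rcases lt_or_ge (infDist x Uᶜ) τ with h | h
    · rcases lt_or_ge (infDist y Uᶜ) τ with h' | h'
      · rw [hg0 x hx h, hg0 y hy h', sub_self, abs_zero]
        exact hκ'.le
      · rw [abs_sub_comm]
        exact hg y hy x hx (by rw [dist_comm]; exact hxy.trans (hm y h'))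
    · exact hg x hx y hy (hxy.trans (hm x h))
  obtain ⟨G, hGb, hGl, hGs, hGg⟩ := exists_boundedOn_lipschitzOn_near
    (div_pos (lt_min ht0 hτ) four_pos) hUd.2.nonempty hκ'.le (fun x _ => hgK x) hgη
  refine ⟨G, ⟨hGb, hGl, τ, hτ, fun x hx y hy => ?_⟩, ?_⟩
  · obtain ⟨hxU, hgx⟩ := hGs x hx
    have h1 : τ ≤ infDist x Uᶜ := not_lt.1 fun h => hgx (hg0 x hxU h)
    have h2 : y ∈ Uᶜ := by
      rw [hUd.1.frontier_eq] at hy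
      exact hy.2
    exact h1.trans (infDist_le_dist_of_mem h2)
  · refine bmoNorm_sub_le ht0 (by linarith) hg hκ.le hκ' (by positivity) hne hGg hf.1
      (fun Q hQ => hGl.integrableOn hQ) hosc fun Q hQ h1 h2 => ?_
    have hc : Q.center ∈ U := hQ (mem_closedBall_self Q.half_pos.le)
    rw [hgu _ hc (h1.trans (le_infDist_compl hne hQ))]
    exact abs_avg_sub_localMean_le hne ht0 hf.1 hosc hQ h1 h2

theorem LipschitzOnWith.osc_le {U : Set (Fin n → ℝ)} {g : (Fin n → ℝ) → ℝ} {L : NNReal}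
    (hg : LipschitzOnWith L g U) {Q : Cube n} (hQ : Q.toSet ⊆ U) : Q.osc g ≤ L * Q.side := by
  have hi := LipschitzOn.integrableOn ⟨L, hg⟩ hQ
  have h1 := Q.osc_le_two_mul hi (g Q.center)
  have h2 : ⨍ x in Q.toSet, |g x - g Q.center| ≤ ⨍ _ in Q.toSet, L * Q.half := by
    refine Q.average_mono (Q.integrableOn_sub_const hi _).abs (Q.integrableOn_const _) fun x hx => ?_
    have := hg.dist_le_mul x (hQ hx) Q.center (hQ (mem_closedBall_self Q.half_pos.le))
    rw [Real.dist_eq] at this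
    refine this.trans ?_
    gcongr
    exact mem_closedBall.1 hx
  rw [Q.average_const] at h2
  unfold Cube.side
  linarith

theorem omegaOn_le_bmoNorm_sub_add {U : Set (Fin n → ℝ)} {f g : (Fin n → ℝ) → ℝ} {lam t : ℝ}
    (hf : MemBmo U lam f) {L : NNReal} (hg : LipschitzOnWith L g U) (ht : 0 ≤ t) (htl : t ≤ lam) :
    omegaOn U f t ≤ bmoNorm U lam (f - g) + L * t := by
  have hgi : ∀ Q : Cube n, Q.toSet ⊆ U → IntegrableOn g Q.toSet := fun Q hQ =>
    LipschitzOn.integrableOn ⟨L, hg⟩ hQ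
  have hneg : ∀ x ∈ U, ∀ y ∈ U, edist ((-g) x) ((-g) y) ≤ L * edist x y := fun x hx y hy => by
    simpa using hg hx hy
  have hgn : LipschitzOnWith L (-g) U := fun x hx y hy => hneg x hx y hy
  have hbdd : BddAbove {r | ∃ Q : Cube n, Q.toSet ⊆ U ∧ Q.side < lam ∧ r = Q.osc (f - g)} := by
    refine ⟨omegaOn U f lam + L * lam, ?_⟩
    rintro _ ⟨Q, hQ, hQl, rfl⟩
    rw [sub_eq_add_neg]
    refine (Q.osc_add_le (hf.1 Q hQ) (hgi Q hQ).neg).trans ?_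
    refine add_le_add (hf.osc_le_omegaOn le_rfl hQ hQl) ((hgn.osc_le hQ).trans ?_)
    gcongr
  have h0 := bmoNorm_nonneg U lam (f - g)
  refine Real.sSup_le ?_ (by positivity)
  rintro _ ⟨Q, hQ, hQt, rfl⟩
  have h1 := Q.osc_add_le ((hf.1 Q hQ).sub (hgi Q hQ)) (hgi Q hQ)
  rw [sub_add_cancel] at h1
  have h2 : Q.osc (f - g) ≤ omegaOn U (f - g) lam :=
    le_csSup hbdd ⟨Q, hQ, hQt.trans_le htl, rfl⟩
  have h3 : Q.osc g ≤ L * t := (hg.osc_le hQ).trans (by gcongr)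
  have h4 := bigAvgSup_nonneg U lam (f - g)
  unfold bmoNorm
  linarith

theorem vanishSmallOsc_of_tendsto {U : Set (Fin n → ℝ)} {f : (Fin n → ℝ) → ℝ} {lam : ℝ}
    (hl : 0 < lam) (hf : MemBmo U lam f) {g : ℕ → (Fin n → ℝ) → ℝ}
    (hg : ∀ j, LipschitzOn U (g j))
    (hlim : Tendsto (fun j => bmoNorm U lam (f - g j)) atTop (𝓝 0)) : VanishSmallOsc U f := by
  refine tendsto_order.2 ⟨fun a ha => Eventually.of_forall fun t =>
    ha.trans_le (omegaOn_nonneg U f t), fun a ha => ?_⟩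
  obtain ⟨j, hj⟩ := (hlim.eventually (gt_mem_nhds ha)).exists
  obtain ⟨L, hL⟩ := hg j
  have hc : Tendsto (fun t : ℝ => bmoNorm U lam (f - g j) + L * t) (𝓝[>] 0)
      (𝓝 (bmoNorm U lam (f - g j))) := by
    have : Continuous fun t : ℝ => bmoNorm U lam (f - g j) + L * t := by fun_prop
    simpa using (this.tendsto 0).mono_left nhdsWithin_le_nhds
  filter_upwards [hc.eventually (gt_mem_nhds hj), Ioc_mem_nhdsGT hl] with t ht htl
  exact (omegaOn_le_bmoNorm_sub_add hf hL htl.1.le htl.2).trans_lt ht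

/-- On an (ε,δ)-domain with λ = λ_{ε,δ}: f ∈ bmo_λ(Ω) is a bmo_λ(Ω)-limit of bounded
Lipschitz functions supported away from ∂Ω iff ω_Ω(f,t) → 0 as t → 0⁺. -/
theorem stmt18 {n : ℕ} (hn : 0 < n) (ε δ : ℝ) (hε : 0 < ε) (hε1 : ε ≤ 1) (hδ : 0 < δ)
    (Ω : Set (Fin n → ℝ)) (hΩ : IsRealDomain Ω) (hed : IsEpsDeltaDomain Ω ε δ)
    (f : (Fin n → ℝ) → ℝ) (hf : MemBmo Ω (lamED n ε δ) f) :
    (∃ g : ℕ → (Fin n → ℝ) → ℝ,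
        (∀ j, BoundedOn Ω (g j) ∧ LipschitzOn Ω (g j) ∧ SuppAway Ω (g j)) ∧
        Tendsto (fun j => bmoNorm Ω (lamED n ε δ) (f - g j)) atTop (nhds 0)) ↔
      VanishSmallOsc Ω f := by
  constructor
  · rintro ⟨g, hg, hlim⟩
    exact vanishSmallOsc_of_tendsto (lamED_pos hn hε hδ) hf (fun j => (hg j).2.1) hlim
  · intro hv
    choose g hg hgle using fun j : ℕ =>
      hv.exists_bmoNorm_sub_le hn hε hε1 hδ hΩ hed hf (Nat.one_div_pos_of_nat (α := ℝ) (n := j))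
    refine ⟨g, hg, squeeze_zero (fun j => bmoNorm_nonneg _ _ _) hgle ?_⟩
    have h : Continuous fun κ : ℝ =>
        3 * (κ + 2 * 3 ^ n * κ * (1 + 4 * n) + (2 * (2 * 3 ^ n * κ) + 4 ^ n * κ)) := by fun_prop
    simpa [Function.comp_def] using
      (h.tendsto 0).comp (tendsto_one_div_add_atTop_nhds_zero_nat (𝕜 := ℝ))
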